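/- Let M₃ be the Turing machine with states {A,B,H} and symbols {0,1,2,3,4} whose transition table is: δ(A,0)=(1,R,B), δ(A,1)=(2,L,A), δ(A,2)=(1,R,A), δ(A,3)=(2,L,B), δ(A,4)=(2,L,A); δ(B,0)=(0,L,A), δ(B,1)=(2,R,B), δ(B,2)=(3,R,B), δ(B,3)=(4,R,A), δ(B,4)=(1,R,H). Let C(n,1) = ^ω0 1 3^n (B0) 0^ω, C(n,2) = ^ω0 2 3^n (B0) 0^ω, C(n,3) = ^ω0 3^n (B0) 0^ω, C(n,4) = ^ω0 4 1 1 3^n (B0) 0^ω, C(n,5) = ^ω0 4 1 2 3^n (B0) 0^ω, C(n,6) = ^ω0 4 1 3^n (B0) 0^ω, C(n,7) = ^ω0 4 2 3^n (B0) 0^ω, C(n,8) = ^ω0 4 3^n (B0) 0^ω. Then: (a) ^ω0 (A0) 0^ω ⊢(1) C(0,1); and for all k ≥ 0: (b) C(2k,1) ⊢(3k²+8k+4) C(3k+1,1); (c) C(2k,2) ⊢(3k²+14k+9) C(3k+2,1); (d) C(2k,3) ⊢(3k²+8k+2) C(3k,1); (e) C(2k,4) ⊢(3k²+8k+8) C(3k+3,1);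 (f) C(2k,5) ⊢(3k²+14k+13) C(3k+4,1); (g) C(2k,6) ⊢(3k²+8k+6) C(3k+2,1); (h) C(2k,7) ⊢(3k²+14k+11) C(3k+3,1); (i) C(2k,8) ⊢(3k²+8k+4) C(3k+1,1); (j) C(2k+1,1) ⊢(3k²+8k+4) C(3k+1,2); (k) C(2k+1,2) ⊢(3k²+8k+4) C(3k+2,3); (l) C(2k+1,3) ⊢(3k²+8k+22) C(3k+1,4); (m) C(2k+1,4) ⊢(3k²+8k+4) C(3k+1,5); (n) C(2k+1,5) ⊢(3k²+8k+4) C(3k+2,6); (o) C(2k+1,6) ⊢(3k²+8k+4) C(3k+1,7); (p) C(2k+1,7) ⊢(3k²+8k+4) C(3k+2,8); (q) C(2k+1,8) ⊢(3k²+5k+3) ^ω0 1 (H2) 2^{3k} 0^ω. -/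

import Mathlib

open Turing

inductive TSt where | A | B | H
deriving DecidableEq

inductive Gam where | s0 | s1 | s2 | s3 | s4
deriving DecidableEq

instance : Inhabited Gam := ⟨Gam.s0⟩

abbrev Cfg := TSt × Tape Gam

/-- The transition table of the machine (values from the halting state `H` are never used). -/
def delta : TSt → Gam → Gam × Dir × TSt
  | .A, .s0 => (.s1, Dir.right, .B)
  | .A, .s1 => (.s2, Dir.left, .A)
  | .A, .s2 => (.s1, Dir.right, .A)
  | .A, .s3 => (.s2, Dir.left, .B)
  | .A, .s4 => (.s2, Dir.left, .A)
  | .B, .s0 => (.s0, Dir.left, .A)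
  | .B, .s1 => (.s2, Dir.right, .B)
  | .B, .s2 => (.s3, Dir.right, .B)
  | .B, .s3 => (.s4, Dir.right, .A)
  | .B, .s4 => (.s1, Dir.right, .H)
  | .H, a => (a, Dir.right, .H)

/-- One computation step; `none` if the current state is the halting state `H`. -/
def step (c : Cfg) : Option Cfg :=
  if c.1 = TSt.H then none
  else
    let t := delta c.1 c.2.head
    some (t.2.2, (c.2.write t.1).move t.2.1)

/-- `reaches t c₁ c₂` : iterating `step` exactly `t` times starting from `c₁` yields `c₂`. -/
def reaches (t : ℕ) (c₁ c₂ : Cfg) : Prop :=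
  (fun c => Option.bind c step)^[t] (some c₁) = some c₂

/-- The configuration `^ω0 x (q a) y 0^ω` : state `q`, head reading `a`, the word `x`
written immediately to the left of the head (in order), `y` immediately to the right,
blank elsewhere. -/
def mkCfg (x : List Gam) (q : TSt) (a : Gam) (y : List Gam) : Cfg :=
  (q, ⟨a, ListBlank.mk x.reverse, ListBlank.mk y⟩)

/-- The eight families of configurations `C(n,p)`, `1 ≤ p ≤ 8`. -/
def Cfg3 (n p : ℕ) : Cfg :=
  match p with
  | 1 => mkCfg ([.s1] ++ List.replicate n .s3) .B .s0 []
  | 2 => mkCfg ([.s2] ++ List.replicate n .s3) .B .s0 []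
  | 3 => mkCfg (List.replicate n .s3) .B .s0 []
  | 4 => mkCfg ([.s4, .s1, .s1] ++ List.replicate n .s3) .B .s0 []
  | 5 => mkCfg ([.s4, .s1, .s2] ++ List.replicate n .s3) .B .s0 []
  | 6 => mkCfg ([.s4, .s1] ++ List.replicate n .s3) .B .s0 []
  | 7 => mkCfg ([.s4, .s2] ++ List.replicate n .s3) .B .s0 []
  | _ => mkCfg ([.s4] ++ List.replicate n .s3) .B .s0 []

theorem reaches_trans {s t : ℕ} {c d e : Cfg} (h₁ : reaches s c d) (h₂ : reaches t d e) :
    reaches (s + t) c e := by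
  unfold reaches at *
  rw [add_comm, Function.iterate_add_apply, h₁, h₂]

theorem reaches_refl (c : Cfg) : reaches 0 c c := rfl

/-- The configuration in state `q` whose head is on the first cell of `R`, with `L` the part of
the tape to the left of the head, read from right to left. -/
def conf (L : ListBlank Gam) (q : TSt) (R : ListBlank Gam) : Cfg :=
  (q, ⟨R.head, L, R.tail⟩)

theorem step_conf (L R : ListBlank Gam) (q : TSt) (a : Gam) :
    step (conf L q (R.cons a)) =
      if q = TSt.H then none else
      some (match delta q a with
        | (w, Dir.left, q') => conf L.tail q' ((R.cons w).cons L.head)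
        | (w, Dir.right, q') => conf (L.cons w) q' R) := by
  unfold step conf
  cases q <;> cases a <;> simp [delta, Tape.write, Tape.move]

/-- The half-tape starting with `n` copies of `a` and continuing as `R`. -/
def rep (a : Gam) : ℕ → ListBlank Gam → ListBlank Gam
  | 0, R => R
  | n + 1, R => (rep a n R).cons a

theorem rep_cons (a : Gam) (n : ℕ) (R : ListBlank Gam) :
    rep a n (R.cons a) = rep a (n + 1) R := by
  induction n with
  | zero => rfl
  | succ n ih => rw [rep, ih]; rfl

theorem mk_replicate_append (a : Gam) (n : ℕ) (l : List Gam) :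
    ListBlank.mk (List.replicate n a ++ l) = rep a n (ListBlank.mk l) := by
  induction n with
  | zero => rfl
  | succ n ih =>
    rw [List.replicate_succ, List.cons_append, ← ListBlank.cons_mk, ih]; rfl

/-- The blank half-tape. -/
def blank : ListBlank Gam := ListBlank.mk []

theorem mk_nil : ListBlank.mk [] = blank := rfl

theorem mk_replicate (a : Gam) (n : ℕ) :
    ListBlank.mk (List.replicate n a) = rep a n blank := by
  simpa [mk_nil] using mk_replicate_append a n []

theorem cons_blank : blank.cons Gam.s0 = blank :=
  ListBlank.cons_head_tail blank

theorem head_blank : blank.head = Gam.s0 := rfl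

theorem tail_blank : blank.tail = blank := rfl

theorem reaches_A_twos (n : ℕ) (L R : ListBlank Gam) :
    reaches n (conf L .A (rep .s2 n R)) (conf (rep .s1 n L) .A R) := by
  induction n generalizing L with
  | zero => rfl
  | succ n ih =>
    rw [add_comm n 1]
    refine reaches_trans (d := conf (L.cons .s1) .A (rep .s2 n R)) ?_ ?_
    · simp [reaches, rep, add_comm 1 n, step_conf, delta]
    · simpa [rep_cons, add_comm] using ih (L.cons .s1)

theorem reaches_B_twos (n : ℕ) (L R : ListBlank Gam) :
    reaches n (conf L .B (rep .s2 n R)) (conf (rep .s3 n L) .B R) := by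
  induction n generalizing L with
  | zero => rfl
  | succ n ih =>
    rw [add_comm n 1]
    refine reaches_trans (d := conf (L.cons .s3) .B (rep .s2 n R)) ?_ ?_
    · simp [reaches, rep, add_comm 1 n, step_conf, delta]
    · simpa [rep_cons, add_comm] using ih (L.cons .s3)

/-- State `A` with the head on the first cell of `L` read leftwards, to the right of which are
`n` twos. -/
def leftConf (L : ListBlank Gam) (n : ℕ) : Cfg :=
  conf L.tail .A ((rep .s2 n blank).cons L.head)

theorem leftConf_one (L : ListBlank Gam) (n : ℕ) :
    reaches 1 (leftConf (L.cons .s1) n) (leftConf L (n + 1)) := by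
  simp [reaches, leftConf, step_conf, delta, rep]

theorem leftConf_four (L : ListBlank Gam) (n : ℕ) :
    reaches 1 (leftConf (L.cons .s4) n) (leftConf L (n + 1)) := by
  simp [reaches, leftConf, step_conf, delta, rep]

theorem leftConf_ones (m : ℕ) (L : ListBlank Gam) (n : ℕ) :
    reaches m (leftConf (rep .s1 m L) n) (leftConf L (n + m)) := by
  induction m generalizing n with
  | zero => rfl
  | succ m ih =>
    have := reaches_trans (leftConf_one (rep .s1 m L) n) (ih (n + 1))
    rwa [add_comm 1 m, add_assoc, add_comm 1 m] at this

theorem conf_blank (L : ListBlank Gam) :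
    reaches 1 (conf L .B blank) (leftConf L 0) := by
  conv in conf _ TSt.B blank => rw [← cons_blank]
  simp only [reaches, leftConf, Function.iterate_one, Option.bind_some, step_conf]
  simp [delta, rep, cons_blank]

/-- From the left end of a block of twos, `A` turns it into ones, bounces off the right end and
returns, having appended one two. -/
theorem reaches_bounce (L : ListBlank Gam) (n : ℕ) :
    reaches (2 * n + 3) (conf L .A (rep .s2 n blank)) (leftConf L (n + 1)) := by
  have h : reaches 1 (conf (rep .s1 n L) .A blank)
      (conf (rep .s1 (n + 1) L) .B blank) := by
    conv in conf _ TSt.A blank => rw [← cons_blank]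
    simp [reaches, step_conf, delta, rep]
  have := reaches_trans (reaches_A_twos n L _)
    (reaches_trans h (reaches_trans (conf_blank _) (leftConf_ones (n + 1) L 0)))
  convert this using 1
  · ring
  · simp

theorem leftConf_two (L : ListBlank Gam) (n : ℕ) :
    reaches (2 * n + 5) (leftConf (L.cons .s2) n) (leftConf L (n + 2)) := by
  simpa [leftConf, rep, mul_add] using reaches_bounce L (n + 1)

theorem leftConf_three (L : ListBlank Gam) (n : ℕ) :
    reaches 1 (leftConf (L.cons .s3) n)
      (conf L.tail .B ((rep .s2 (n + 1) blank).cons L.head)) := by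
  simp [reaches, leftConf, step_conf, delta, rep]

theorem leftConf_three_three (L : ListBlank Gam) (n : ℕ) :
    reaches (2 * n + 8) (leftConf ((L.cons .s3).cons .s3) n) (leftConf L (n + 3)) := by
  have h : reaches 1 (conf L .B ((rep .s2 (n + 1) blank).cons .s3))
      (conf (L.cons .s4) .A (rep .s2 (n + 1) blank)) := by
    simp [reaches, step_conf, delta]
  have h' := leftConf_three (L.cons .s3) n
  rw [ListBlank.tail_cons, ListBlank.head_cons] at h'
  have := reaches_trans h' (reaches_trans h (reaches_trans
    (reaches_bounce (L.cons .s4) (n + 1)) (leftConf_four L (n + 1 + 1))))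
  convert this using 1
  ring

theorem leftConf_threes (k : ℕ) (L : ListBlank Gam) :
    reaches (3 * k ^ 2 + 5 * k) (leftConf (rep .s3 (2 * k) L) 0) (leftConf L (3 * k)) := by
  induction k generalizing L with
  | zero => rfl
  | succ k ih =>
    have := reaches_trans (ih ((L.cons .s3).cons .s3)) (leftConf_three_three L (3 * k))
    rw [rep_cons, rep_cons] at this
    convert this using 1
    · ring
    · rfl
    · rfl

theorem reaches_leftConf_even (k : ℕ) (L : ListBlank Gam) :
    reaches (3 * k ^ 2 + 5 * k + 1) (conf (rep .s3 (2 * k) L) .B blank)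
      (leftConf L (3 * k)) := by
  have := reaches_trans (conf_blank (rep .s3 (2 * k) L)) (leftConf_threes k L)
  rwa [add_comm 1] at this

theorem reaches_odd (k : ℕ) (L : ListBlank Gam) :
    reaches (3 * k ^ 2 + 5 * k + 2) (conf (rep .s3 (2 * k + 1) L) .B blank)
      (conf L.tail .B ((rep .s2 (3 * k + 1) blank).cons L.head)) := by
  have := reaches_trans (reaches_leftConf_even k (L.cons .s3)) (leftConf_three L _)
  rwa [rep_cons] at this

theorem leftConf_blank (n : ℕ) :
    reaches (n + 1) (leftConf blank n)
      (conf (rep .s3 n (blank.cons .s1)) .B blank) := by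
  rw [add_comm]
  refine reaches_trans (s := 1) ?_ (reaches_B_twos _ _ _)
  simp [reaches, leftConf, head_blank, tail_blank, step_conf, delta]

theorem reaches_odd_one (k : ℕ) (L : ListBlank Gam) :
    reaches (3 * k ^ 2 + 8 * k + 4) (conf (rep .s3 (2 * k + 1) (L.cons .s1)) .B blank)
      (conf (rep .s3 (3 * k + 1) (L.cons .s2)) .B blank) := by
  have h : reaches 1 (conf L .B ((rep .s2 (3 * k + 1) blank).cons .s1))
      (conf (L.cons .s2) .B (rep .s2 (3 * k + 1) blank)) := by
    simp [reaches, step_conf, delta]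
  have h' := reaches_odd k (L.cons .s1)
  rw [ListBlank.tail_cons, ListBlank.head_cons] at h'
  have := reaches_trans h' (reaches_trans h (reaches_B_twos _ _ _))
  convert this using 1
  ring

theorem reaches_odd_two (k : ℕ) (L : ListBlank Gam) :
    reaches (3 * k ^ 2 + 8 * k + 4) (conf (rep .s3 (2 * k + 1) (L.cons .s2)) .B blank)
      (conf (rep .s3 (3 * k + 2) L) .B blank) := by
  have h := reaches_B_twos (3 * k + 2) L blank
  have h' := reaches_odd k (L.cons .s2)
  rw [ListBlank.tail_cons, ListBlank.head_cons] at h'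
  have := reaches_trans h' h
  convert this using 1
  ring

theorem reaches_odd_blank (k : ℕ) :
    reaches (3 * k ^ 2 + 8 * k + 22) (conf (rep .s3 (2 * k + 1) blank) .B blank)
      (conf (rep .s3 (3 * k + 1) (((blank.cons .s4).cons .s1).cons .s1)) .B blank) := by
  have h (R : ListBlank Gam) : reaches 19 (conf blank .B (R.cons .s0))
      (conf (((blank.cons .s4).cons .s1).cons .s1) .B R) := by
    simp [reaches, step_conf, delta, head_blank, tail_blank]
  have := reaches_trans (reaches_odd k blank)
    (reaches_trans (h _) (reaches_B_twos _ _ _))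
  convert this using 1
  ring

theorem reaches_odd_four (k : ℕ) :
    reaches (3 * k ^ 2 + 5 * k + 3) (conf (rep .s3 (2 * k + 1) (blank.cons .s4)) .B blank)
      (conf (blank.cons .s1) .H (rep .s2 (3 * k + 1) blank)) := by
  refine reaches_trans (reaches_odd k _) (t := 1) ?_
  simp [reaches, step_conf, delta]

theorem mkCfg_eq_conf (x y : List Gam) (q : TSt) (a : Gam) :
    mkCfg x q a y = conf (ListBlank.mk x.reverse) q ((ListBlank.mk y).cons a) := by
  simp [mkCfg, conf]

/-- After an even block of threes is consumed, `t` steps reducing `L` to blank tape complete the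
run to a new block of threes preceded by a single one. -/
theorem reaches_even_of_leftConf {k t n : ℕ} {L : ListBlank Gam}
    (h : reaches t (leftConf L (3 * k)) (leftConf blank n)) :
    reaches (3 * k ^ 2 + 5 * k + 1 + (t + (n + 1)))
      (conf (rep .s3 (2 * k) L) .B blank)
      (conf (rep .s3 n (blank.cons .s1)) .B blank) :=
  reaches_trans (reaches_leftConf_even k L) (reaches_trans h (leftConf_blank n))

theorem stmt6 :
    reaches 1 (mkCfg [] .A .s0 []) (Cfg3 0 1) ∧
    ∀ k : ℕ,
      reaches (3*k^2 + 8*k + 4) (Cfg3 (2*k) 1) (Cfg3 (3*k+1) 1) ∧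
      reaches (3*k^2 + 14*k + 9) (Cfg3 (2*k) 2) (Cfg3 (3*k+2) 1) ∧
      reaches (3*k^2 + 8*k + 2) (Cfg3 (2*k) 3) (Cfg3 (3*k) 1) ∧
      reaches (3*k^2 + 8*k + 8) (Cfg3 (2*k) 4) (Cfg3 (3*k+3) 1) ∧
      reaches (3*k^2 + 14*k + 13) (Cfg3 (2*k) 5) (Cfg3 (3*k+4) 1) ∧
      reaches (3*k^2 + 8*k + 6) (Cfg3 (2*k) 6) (Cfg3 (3*k+2) 1) ∧
      reaches (3*k^2 + 14*k + 11) (Cfg3 (2*k) 7) (Cfg3 (3*k+3) 1) ∧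
      reaches (3*k^2 + 8*k + 4) (Cfg3 (2*k) 8) (Cfg3 (3*k+1) 1) ∧
      reaches (3*k^2 + 8*k + 4) (Cfg3 (2*k+1) 1) (Cfg3 (3*k+1) 2) ∧
      reaches (3*k^2 + 8*k + 4) (Cfg3 (2*k+1) 2) (Cfg3 (3*k+2) 3) ∧
      reaches (3*k^2 + 8*k + 22) (Cfg3 (2*k+1) 3) (Cfg3 (3*k+1) 4) ∧
      reaches (3*k^2 + 8*k + 4) (Cfg3 (2*k+1) 4) (Cfg3 (3*k+1) 5) ∧
      reaches (3*k^2 + 8*k + 4) (Cfg3 (2*k+1) 5) (Cfg3 (3*k+2) 6) ∧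
      reaches (3*k^2 + 8*k + 4) (Cfg3 (2*k+1) 6) (Cfg3 (3*k+1) 7) ∧
      reaches (3*k^2 + 8*k + 4) (Cfg3 (2*k+1) 7) (Cfg3 (3*k+2) 8) ∧
      reaches (3*k^2 + 5*k + 3) (Cfg3 (2*k+1) 8)
        (mkCfg [.s1] .H .s2 (List.replicate (3*k) .s2)) := by
  simp only [Cfg3, mkCfg_eq_conf, List.reverse_replicate, mk_replicate_append,
    mk_replicate, cons_blank, List.reverse_cons, List.reverse_nil, List.nil_append,
    List.cons_append, List.append_assoc, ← ListBlank.cons_mk, mk_nil]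
  refine ⟨?_, fun k => ⟨?_, ?_, ?_, ?_, ?_, ?_, ?_, ?_, reaches_odd_one k _, reaches_odd_two k _,
    reaches_odd_blank k, reaches_odd_one k _, reaches_odd_two k _, reaches_odd_one k _,
    reaches_odd_two k _, reaches_odd_four k⟩⟩
  · simpa [leftConf, rep, head_blank, tail_blank, cons_blank] using leftConf_blank 0
  · convert reaches_even_of_leftConf (leftConf_one _ _) using 1
    ring
  · convert reaches_even_of_leftConf (leftConf_two _ _) using 1
    ring
  · convert reaches_even_of_leftConf (reaches_refl _) using 1
    ring
  · convert reaches_even_of_leftConf (reaches_trans (leftConf_one _ _)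
      (reaches_trans (leftConf_one _ _) (leftConf_four _ _))) using 1
    ring
  · convert reaches_even_of_leftConf (reaches_trans (leftConf_two _ _)
      (reaches_trans (leftConf_one _ _) (leftConf_four _ _))) using 1
    ring
  · convert reaches_even_of_leftConf (reaches_trans (leftConf_one _ _) (leftConf_four _ _)) using 1
    ring
  · convert reaches_even_of_leftConf (reaches_trans (leftConf_two _ _) (leftConf_four _ _)) using 1
    ring
  · convert reaches_even_of_leftConf (leftConf_four _ _) using 1
    ring
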